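/- Let ρ be a positive Borel measure on (0,∞) with ρ((0,r]) < ∞ and ∫_{(r,∞)} u^{-1} dρ(u) < ∞ for all r > 0, let c₀ ≤ 0, ψ(s) := c₀ + ∫_{(0,∞)}(e^{su} − 1)u^{-1}dρ(u) for s ≤ 0, and define ψ(A)y := c₀ y + ∫_{(0,∞)}(T(u)y − y)u^{-1}dρ(u) whenever this Bochner integral exists. Suppose the function 1/ψ is the Laplace transform of a complex Borel measure a on [0,∞) whose distribution function a(t) = a([0,t]) satisfies a({0}) = 0 and a(t)‖T(t)x‖ → 0 as t → ∞ for all x ∈ X, and suppose the operator (1/ψ)(A)x := ∫₀^∞ T(t)x da(t) is defined for all x ∈ X and bounded on X. Then for every x ∈ D(A): the Bochner integral defining ψ(A)((1/ψ)(A)x) exists and ψ(A)((1/ψ)(A)x) = x, and (1/ψ)(A)(ψ(A)x) = x. -/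

import Mathlib

open MeasureTheory Filter Topology Set

noncomputable section

/-- `IsGen T x y` means `x` lies in the domain `D(A)` of the generator `A` of the
`C₀`-semigroup `T` and `A x = y`. -/
def IsGen {X : Type*} [NormedAddCommGroup X] [NormedSpace ℂ X]
    (T : ℝ → X →L[ℂ] X) (x y : X) : Prop :=
  Tendsto (fun t : ℝ => t⁻¹ • (T t x - x)) (𝓝[>] (0 : ℝ)) (𝓝 y)

/-- The distribution function `t ↦ a([0,t])` of the complex measure `da = h dμ`. -/
def distFun (μ : MeasureTheory.Measure ℝ) (h : ℝ → ℂ) (t : ℝ) : ℂ :=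
  ∫ s in Icc (0 : ℝ) t, h s ∂μ

lemma expApprox {X : Type*} [NormedAddCommGroup X] [NormedSpace ℝ X]
    (q : ℝ → X) (hq : ContinuousOn q (Ici 0)) (hq0 : Tendsto q atTop (𝓝 0)) (ε : ℝ) (hε : 0 < ε) :
    ∃ (N : ℕ) (w : ℕ → X), ∀ v : ℝ, 0 ≤ v →
      ‖q v - ∑ n ∈ Finset.range N, Real.exp (-(n : ℝ) * v) • w n‖ ≤ ε := by
  classical
  let G : unitInterval → X := fun x => if (x : ℝ) = 0 then 0 else q (-Real.log x)
  have hGz : ∀ y : unitInterval, (y : ℝ) = 0 → G y = 0 := fun y hy => if_pos hy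
  have hGn : ∀ y : unitInterval, (y : ℝ) ≠ 0 → G y = q (-Real.log y) := fun y hy => if_neg hy
  have hG : Continuous G := by
    rw [continuous_iff_continuousAt]
    intro x
    by_cases hx : (x : ℝ) = 0
    · have hGx : G x = 0 := hGz x hx
      rw [ContinuousAt, hGx, Metric.tendsto_nhds]
      intro δ hδ
      have h1 : ∀ᶠ r in atTop, dist (q r) 0 < δ := (Metric.tendsto_nhds.1 hq0) δ hδ
      have h2 : Tendsto (fun r : ℝ => -Real.log r) (𝓝[>] 0) atTop :=
        tendsto_neg_atBot_atTop.comp Real.tendsto_log_nhdsGT_zero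
      have h3 := h2.eventually h1
      rw [eventually_nhdsWithin_iff] at h3
      have h4 : Tendsto (fun y : unitInterval => (y : ℝ)) (𝓝 x) (𝓝 0) := by
        have := (continuous_subtype_val (p := fun y : ℝ => y ∈ unitInterval)).tendsto x
        rwa [hx] at this
      filter_upwards [h4.eventually h3] with y hy
      by_cases hy0 : (y : ℝ) = 0
      · rw [hGz y hy0, dist_self]; exact hδ
      · rw [hGn y hy0]
        exact hy (lt_of_le_of_ne y.2.1 (Ne.symm hy0))
    · have hev : ∀ᶠ y : unitInterval in 𝓝 x, (y : ℝ) ≠ 0 :=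
        (continuous_subtype_val.continuousAt).eventually_ne hx
      have : ContinuousAt (fun y : unitInterval => q (-Real.log y)) x := by
        have h1 : ContinuousWithinAt q (Ici 0) (-Real.log x) :=
          hq _ (by simpa using Real.log_nonpos x.2.1 x.2.2)
        have h2 : Tendsto (fun y : unitInterval => -Real.log y) (𝓝 x) (𝓝[Ici 0] (-Real.log x)) := by
          refine tendsto_nhdsWithin_iff.2 ⟨?_, Eventually.of_forall fun y => ?_⟩
          · exact ((Real.continuousAt_log hx).comp continuous_subtype_val.continuousAt).neg
          · simpa using Real.log_nonpos y.2.1 y.2.2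
        exact Tendsto.comp h1 h2
      refine this.congr ?_
      filter_upwards [hev] with y hy
      exact (hGn y hy).symm
  have hb := bernsteinApproximation_uniform (⟨G, hG⟩ : C(unitInterval, X))
  rw [Metric.tendsto_atTop] at hb
  obtain ⟨m, hm⟩ := hb ε hε
  specialize hm m le_rfl
  let N : ℕ := (∑ k : Fin (m + 1), (bernsteinPolynomial ℝ m k).natDegree) + 1
  let w : ℕ → X := fun i => ∑ k : Fin (m + 1), (bernsteinPolynomial ℝ m k).coeff i • G (bernstein.z k)
  refine ⟨N, w, fun v hv => ?_⟩
  have hI : Real.exp (-v) ∈ unitInterval := ⟨(Real.exp_pos _).le, by simpa using hv⟩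
  have h1 := (ContinuousMap.dist_lt_iff hε).1 hm ⟨Real.exp (-v), hI⟩
  rw [bernsteinApproximation.apply, dist_comm, dist_eq_norm] at h1
  have h2 : G ⟨Real.exp (-v), hI⟩ = q v := by
    rw [hGn _ (Real.exp_ne_zero _)]; simp
  have h3 : ∑ n ∈ Finset.range N, Real.exp (-(n : ℝ) * v) • w n =
      ∑ k : Fin (m + 1), bernstein m k ⟨Real.exp (-v), hI⟩ • G (bernstein.z k) := by
    simp only [w, Finset.smul_sum]
    rw [Finset.sum_comm]
    refine Finset.sum_congr rfl fun k _ => ?_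
    have : bernstein m k ⟨Real.exp (-v), hI⟩ = (bernsteinPolynomial ℝ m k).eval (Real.exp (-v)) := rfl
    rw [this, Polynomial.eval_eq_sum_range' (n := N), Finset.sum_smul]
    · refine Finset.sum_congr rfl fun i _ => ?_
      rw [smul_smul, ← Real.exp_nat_mul]
      congr 1
      rw [mul_comm]; congr 2; ring
    · exact Nat.lt_succ_of_le (Finset.single_le_sum
        (f := fun k : Fin (m+1) => (bernsteinPolynomial ℝ m k).natDegree) (fun _ _ => Nat.zero_le _) (Finset.mem_univ k))
  rw [h3, ← h2]
  exact h1.le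

lemma growth {X : Type*} [NormedAddCommGroup X] [NormedSpace ℝ X]
    (g g' : ℝ → X) (σ ε : ℝ) (hσ : 0 < σ) (hg : ContinuousOn g (Ici 0))
    (hg' : ∀ v, 0 ≤ v → HasDerivWithinAt g (g' v) (Ici v) v)
    (hb : ∀ v, 0 ≤ v → ‖g' v‖ ≤ ε * Real.exp (-σ * v)) (a b : ℝ) (ha : 0 ≤ a) (hab : a ≤ b) :
    ‖g b - g a‖ ≤ ε / σ * (Real.exp (-σ * a) - Real.exp (-σ * b)) := by
  have := image_norm_le_of_norm_deriv_right_le_deriv_boundary (f := fun t => g t - g a) (f' := g')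
    (a := a) (b := b) (B := fun t => ε / σ * (Real.exp (-σ * a) - Real.exp (-σ * t)))
    (B' := fun t => ε * Real.exp (-σ * t)) ?_ ?_ ?_ ?_ ?_ (right_mem_Icc.2 hab)
  · exact this
  · exact (hg.mono fun t ht => ha.trans ht.1).sub continuousOn_const
  · intro v hv
    exact (hg' v (ha.trans hv.1)).sub_const _
  · simp
  · intro v
    have h1 : HasDerivAt (fun t => Real.exp (-σ * t)) (Real.exp (-σ * v) * (-σ * 1)) v :=
      ((hasDerivAt_id v).const_mul (-σ)).exp
    have := (h1.const_sub (Real.exp (-σ * a))).const_mul (ε / σ)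
    refine this.congr_deriv ?_
    field_simp
  · intro v hv
    exact hb v (ha.trans hv.1)

lemma rhoInt {X : Type*} [NormedAddCommGroup X] [NormedSpace ℝ X]
    (ρ : Measure ℝ)
    (hρfin : ∀ r : ℝ, 0 < r → ρ (Ioc (0 : ℝ) r) < ⊤)
    (hρint : ∀ r : ℝ, 0 < r → IntegrableOn (fun u : ℝ => u⁻¹) (Ioi r) ρ)
    (g : ℝ → X) (hg : ContinuousOn g (Ioi 0)) (C : ℝ) (h1 : ∀ u, 0 < u → ‖g u‖ ≤ C)
    (h2 : ∀ u, 0 < u → ‖g u‖ ≤ C * u) :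
    IntegrableOn (fun u => u⁻¹ • g u) (Ioi 0) ρ := by
  have hc : ContinuousOn (fun u : ℝ => u⁻¹ • g u) (Ioi 0) :=
    (continuousOn_inv₀.mono fun u hu => ne_of_gt hu).smul hg
  rw [← Ioc_union_Ioi_eq_Ioi (zero_le_one (α := ℝ))]
  refine IntegrableOn.union ?_ ?_
  · refine Integrable.mono' (integrableOn_const (C := C) (hρfin 1 one_pos).ne)
      ((hc.mono fun u hu => hu.1).aestronglyMeasurable measurableSet_Ioc) ?_
    refine (ae_restrict_iff' measurableSet_Ioc).2 (Eventually.of_forall fun u hu => ?_)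
    rw [norm_smul, norm_inv, Real.norm_of_nonneg hu.1.le, inv_mul_le_iff₀ hu.1, mul_comm]
    exact h2 u hu.1
  · refine Integrable.mono' ((hρint 1 one_pos).const_mul C)
      ((hc.mono fun u (hu : 1 < u) => (zero_lt_one.trans hu : (0:ℝ) < u)).aestronglyMeasurable measurableSet_Ioi) ?_
    refine (ae_restrict_iff' measurableSet_Ioi).2 (Eventually.of_forall fun u hu => ?_)
    have hu : 0 < u := zero_lt_one.trans (show (1:ℝ) < u from hu)
    rw [norm_smul, norm_inv, Real.norm_of_nonneg hu.le, mul_comm]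
    have := h1 u hu
    gcongr

lemma one_sub_exp_int (ρ : Measure ℝ)
    (hρfin : ∀ r : ℝ, 0 < r → ρ (Ioc (0 : ℝ) r) < ⊤)
    (hρint : ∀ r : ℝ, 0 < r → IntegrableOn (fun u : ℝ => u⁻¹) (Ioi r) ρ) (σ : ℝ) (hσ : 0 < σ) :
    IntegrableOn (fun u => u⁻¹ * (1 - Real.exp (-σ * u))) (Ioi 0) ρ := by
  have key : ∀ u : ℝ, 0 < u → ‖1 - Real.exp (-σ * u)‖ = 1 - Real.exp (-σ * u) := fun u hu => by
    refine Real.norm_of_nonneg ?_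
    have : Real.exp (-σ * u) ≤ 1 := Real.exp_le_one_iff.2 (by nlinarith)
    linarith
  refine rhoInt ρ hρfin hρint (fun u => 1 - Real.exp (-σ * u)) (by fun_prop) (1 + σ) ?_ ?_
  · intro u hu
    rw [key u hu]
    have := Real.exp_pos (-σ * u)
    linarith
  · intro u hu
    rw [key u hu]
    have := Real.add_one_le_exp (-σ * u)
    nlinarith

lemma exp_single {X : Type*} [NormedAddCommGroup X] [NormedSpace ℝ X] [CompleteSpace X]
    (ρ : Measure ℝ)
    (hρfin : ∀ r : ℝ, 0 < r → ρ (Ioc (0 : ℝ) r) < ⊤)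
    (hρint : ∀ r : ℝ, 0 < r → IntegrableOn (fun u : ℝ => u⁻¹) (Ioi r) ρ) (c₀ l : ℝ) (hl : l < 0)
    (t : ℝ) (z : X) :
    IntegrableOn (fun u => u⁻¹ • (Real.exp (l * (t + u)) • z - Real.exp (l * t) • z)) (Ioi 0) ρ ∧
    c₀ • (Real.exp (l * t) • z) +
      ∫ u in Ioi 0, u⁻¹ • (Real.exp (l * (t + u)) • z - Real.exp (l * t) • z) ∂ρ =
    (Real.exp (l * t) * (c₀ + ∫ u in Ioi (0 : ℝ), (Real.exp (l * u) - 1) * u⁻¹ ∂ρ)) • z := by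
  have h0 := one_sub_exp_int ρ hρfin hρint (-l) (by linarith)
  have h1 : IntegrableOn (fun u => (Real.exp (l * u) - 1) * u⁻¹) (Ioi 0) ρ := by
    refine h0.neg.congr (Eventually.of_forall fun u => ?_)
    simp only [Pi.neg_apply, neg_neg]
    ring
  have h2 : (fun u => u⁻¹ • (Real.exp (l * (t + u)) • z - Real.exp (l * t) • z)) =
      fun u => ((Real.exp (l * u) - 1) * u⁻¹) • (Real.exp (l * t) • z) := by
    funext u
    rw [← sub_smul, smul_smul, smul_smul]
    congr 1
    rw [mul_add, Real.exp_add]; ring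
  rw [h2]
  refine ⟨h1.smul_const _, ?_⟩
  rw [integral_smul_const, ← add_smul, smul_smul, mul_comm]

lemma core_abs {X : Type*} [NormedAddCommGroup X] [NormedSpace ℂ X] [CompleteSpace X]
    (ρ : Measure ℝ)
    (hρfin : ∀ r : ℝ, 0 < r → ρ (Ioc (0 : ℝ) r) < ⊤)
    (hρint : ∀ r : ℝ, 0 < r → IntegrableOn (fun u : ℝ => u⁻¹) (Ioi r) ρ)
    (c₀ : ℝ) (μ : Measure ℝ) (h : ℝ → ℂ) (hnorm : ∀ t, ‖h t‖ = 1)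
    (hlap : ∀ s : ℝ, s < 0 →
      IntegrableOn (fun t => Complex.exp ((s * t : ℝ) : ℂ) * h t) (Ici (0 : ℝ)) μ ∧
      ((c₀ + ∫ u in Ioi (0 : ℝ), (Real.exp (s * u) - 1) * u⁻¹ ∂ρ : ℝ) : ℂ) *
        (∫ t in Ici (0 : ℝ), Complex.exp ((s * t : ℝ) : ℂ) * h t ∂μ) = 1)
    (σ : ℝ) (hσ : 0 < σ) (f q : ℝ → X) (hf : ContinuousOn f (Ici 0))
    (hf' : ∀ v, 0 ≤ v → HasDerivWithinAt f (Real.exp (-σ * v) • q v) (Ici v) v)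
    (hq : ContinuousOn q (Ici 0)) (hq0 : Tendsto q atTop (𝓝 0)) (hf0 : Tendsto f atTop (𝓝 0))
    (hfint : ∀ t, 0 ≤ t → IntegrableOn (fun u => u⁻¹ • (f (t + u) - f t)) (Ioi 0) ρ)
    (hDf : IntegrableOn (fun t => h t • (c₀ • f t + ∫ u in Ioi 0, u⁻¹ • (f (t + u) - f t) ∂ρ))
      (Ici 0) μ) :
    ∫ t in Ici 0, h t • (c₀ • f t + ∫ u in Ioi 0, u⁻¹ • (f (t + u) - f t) ∂ρ) ∂μ = f 0 := by
  set K0 := ∫ u in Ioi 0, u⁻¹ * (1 - Real.exp (-σ * u)) ∂ρ with hK0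
  have hK0i := one_sub_exp_int ρ hρfin hρint σ hσ
  have hEi : IntegrableOn (fun t => Real.exp (-σ * t)) (Ici 0) μ := by
    refine (hlap (-σ) (by linarith)).1.norm.congr (Eventually.of_forall fun t => ?_)
    simp only [norm_mul, hnorm, mul_one, Complex.norm_exp, Complex.ofReal_re]
  set E0 := ∫ t in Ici 0, Real.exp (-σ * t) ∂μ with hE0
  set K := (|c₀| + K0) / σ * E0 + 1 / σ with hK
  have main : ∀ ε : ℝ, 0 < ε →
    ‖(∫ t in Ici 0, h t • (c₀ • f t + ∫ u in Ioi 0, u⁻¹ • (f (t + u) - f t) ∂ρ) ∂μ) - f 0‖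
      ≤ ε * K := by
    intro ε hε
    obtain ⟨N, w, hw⟩ := expApprox q hq hq0 ε hε
    let l : ℕ → ℝ := fun n => -σ - n
    have hl : ∀ n, l n < 0 := fun n => by
      have : (0 : ℝ) ≤ n := Nat.cast_nonneg n
      simp only [l]; linarith
    let z : ℕ → X := fun n => (l n)⁻¹ • w n
    let p : ℝ → X := fun v => ∑ n ∈ Finset.range N, Real.exp (l n * v) • z n
    have hp' : ∀ v, HasDerivAt p
        (Real.exp (-σ * v) • ∑ n ∈ Finset.range N, Real.exp (-(n : ℝ) * v) • w n) v := by
      intro v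
      have : HasDerivAt p (∑ n ∈ Finset.range N, (Real.exp (l n * v) * (l n * 1)) • z n) v := by
        refine HasDerivAt.fun_sum fun n _ => ?_
        exact (((hasDerivAt_id v).const_mul (l n)).exp).smul_const (z n)
      convert this using 1
      rw [Finset.smul_sum]
      refine Finset.sum_congr rfl fun n _ => ?_
      simp only [z, smul_smul]
      congr 1
      rw [← Real.exp_add, mul_one, mul_assoc, mul_inv_cancel₀ (hl n).ne, mul_one]
      congr 1
      simp only [l]; ring
    have hp0 : Tendsto p atTop (𝓝 0) := by
      have : Tendsto p atTop (𝓝 (∑ n ∈ Finset.range N, (0 : ℝ) • z n)) := by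
        refine tendsto_finsetSum _ fun n _ => Tendsto.smul_const ?_ _
        exact Real.tendsto_exp_atBot.comp (tendsto_id.const_mul_atTop_of_neg (hl n))
      simpa using this
    have hgr : ∀ a b : ℝ, 0 ≤ a → a ≤ b → ‖(f b - p b) - (f a - p a)‖ ≤
        ε / σ * (Real.exp (-σ * a) - Real.exp (-σ * b)) := by
      intro a b ha hab
      refine growth (fun v => f v - p v) (fun v => Real.exp (-σ * v) • q v -
        Real.exp (-σ * v) • ∑ n ∈ Finset.range N, Real.exp (-(n : ℝ) * v) • w n) σ ε hσ ?_ ?_ ?_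
        a b ha hab
      · exact hf.sub fun v _ => (hp' v).continuousAt.continuousWithinAt
      · exact fun v hv => (hf' v hv).sub (hp' v).hasDerivWithinAt
      · intro v hv
        rw [← smul_sub, norm_smul, Real.norm_of_nonneg (Real.exp_pos _).le, mul_comm]
        have := hw v hv
        have := Real.exp_pos (-σ * v)
        gcongr
    have hg0 : ∀ a : ℝ, 0 ≤ a → ‖f a - p a‖ ≤ ε / σ * Real.exp (-σ * a) := by
      intro a ha
      have h1 : Tendsto (fun b => ‖(f b - p b) - (f a - p a)‖) atTop (𝓝 ‖f a - p a‖) := by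
        have := ((hf0.sub hp0).sub_const (f a - p a)).norm
        simpa only [sub_zero, zero_sub, norm_neg] using this
      refine le_of_tendsto h1 ?_
      filter_upwards [eventually_ge_atTop a] with b hb
      refine (hgr a b ha hb).trans ?_
      have := Real.exp_pos (-σ * b)
      gcongr
      linarith
    have hpint : ∀ t, IntegrableOn (fun u => u⁻¹ • (p (t + u) - p t)) (Ioi 0) ρ ∧
        c₀ • p t + ∫ u in Ioi 0, u⁻¹ • (p (t + u) - p t) ∂ρ =
        ∑ n ∈ Finset.range N, (Real.exp (l n * t) *
          (c₀ + ∫ u in Ioi (0 : ℝ), (Real.exp (l n * u) - 1) * u⁻¹ ∂ρ)) • z n := by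
      intro t
      have hs := fun n => exp_single ρ hρfin hρint c₀ (l n) (hl n) t (z n)
      have he : (fun u => u⁻¹ • (p (t + u) - p t)) = fun u => ∑ n ∈ Finset.range N,
          u⁻¹ • (Real.exp (l n * (t + u)) • z n - Real.exp (l n * t) • z n) := by
        funext u
        simp only [p]
        rw [← Finset.sum_sub_distrib, Finset.smul_sum]
      rw [he]
      refine ⟨integrable_finsetSum _ fun n _ => (hs n).1, ?_⟩
      rw [integral_finsetSum _ fun n _ => (hs n).1]
      simp only [p]
      rw [Finset.smul_sum, ← Finset.sum_add_distrib]
      exact Finset.sum_congr rfl fun n _ => (hs n).2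
    have hpμ1 : ∀ n t, h t • (Real.exp (l n * t) *
          (c₀ + ∫ u in Ioi (0 : ℝ), (Real.exp (l n * u) - 1) * u⁻¹ ∂ρ)) • z n =
          (Complex.exp ((l n * t : ℝ) : ℂ) * h t) •
            (((c₀ + ∫ u in Ioi (0 : ℝ), (Real.exp (l n * u) - 1) * u⁻¹ ∂ρ : ℝ) : ℂ) • z n) := by
      intro n t
      rw [← Complex.coe_smul (Real.exp (l n * t) * _), smul_smul, smul_smul]
      congr 1
      rw [Complex.ofReal_mul, Complex.ofReal_exp]
      ring
    have hpμ : IntegrableOn (fun t => h t • (c₀ • p t + ∫ u in Ioi 0, u⁻¹ • (p (t + u) - p t) ∂ρ))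
        (Ici 0) μ ∧
        ∫ t in Ici 0, h t • (c₀ • p t + ∫ u in Ioi 0, u⁻¹ • (p (t + u) - p t) ∂ρ) ∂μ = p 0 := by
      have he : (fun t => h t • (c₀ • p t + ∫ u in Ioi 0, u⁻¹ • (p (t + u) - p t) ∂ρ)) =
          fun t => ∑ n ∈ Finset.range N, (Complex.exp ((l n * t : ℝ) : ℂ) * h t) •
            (((c₀ + ∫ u in Ioi (0 : ℝ), (Real.exp (l n * u) - 1) * u⁻¹ ∂ρ : ℝ) : ℂ) • z n) := by
        funext t
        rw [(hpint t).2, Finset.smul_sum]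
        exact Finset.sum_congr rfl fun n _ => hpμ1 n t
      have hi : ∀ n, IntegrableOn (fun t => (Complex.exp ((l n * t : ℝ) : ℂ) * h t) •
            (((c₀ + ∫ u in Ioi (0 : ℝ), (Real.exp (l n * u) - 1) * u⁻¹ ∂ρ : ℝ) : ℂ) • z n))
            (Ici 0) μ := fun n => (hlap (l n) (hl n)).1.smul_const _
      rw [he]
      refine ⟨integrable_finsetSum _ fun n _ => hi n, ?_⟩
      rw [integral_finsetSum _ fun n _ => hi n]
      simp only [p]
      refine Finset.sum_congr rfl fun n _ => ?_
      rw [integral_smul_const, smul_smul, mul_comm, (hlap (l n) (hl n)).2]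
      simp
    have hDd : ∀ t, 0 ≤ t → ‖h t • (c₀ • f t + ∫ u in Ioi 0, u⁻¹ • (f (t + u) - f t) ∂ρ) -
        h t • (c₀ • p t + ∫ u in Ioi 0, u⁻¹ • (p (t + u) - p t) ∂ρ)‖ ≤
        ε * ((|c₀| + K0) / σ) * Real.exp (-σ * t) := by
      intro t ht
      rw [← smul_sub, norm_smul, hnorm, one_mul]
      have e1 : (c₀ • f t + ∫ u in Ioi 0, u⁻¹ • (f (t + u) - f t) ∂ρ) -
          (c₀ • p t + ∫ u in Ioi 0, u⁻¹ • (p (t + u) - p t) ∂ρ) =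
          c₀ • (f t - p t) +
            ∫ u in Ioi 0, (u⁻¹ • (f (t + u) - f t) - u⁻¹ • (p (t + u) - p t)) ∂ρ := by
        rw [integral_sub (hfint t ht) (hpint t).1, smul_sub]
        abel
      rw [e1]
      have e2 : ‖∫ u in Ioi 0, (u⁻¹ • (f (t + u) - f t) - u⁻¹ • (p (t + u) - p t)) ∂ρ‖ ≤
          ∫ u in Ioi 0, (ε / σ * Real.exp (-σ * t)) * (u⁻¹ * (1 - Real.exp (-σ * u))) ∂ρ := by
        refine norm_integral_le_of_norm_le (hK0i.const_mul _) ?_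
        refine (ae_restrict_iff' measurableSet_Ioi).2 (Eventually.of_forall fun u hu => ?_)
        have hu : 0 < u := hu
        have := hgr t (t + u) ht (by linarith)
        rw [← smul_sub, norm_smul, norm_inv, Real.norm_of_nonneg hu.le]
        have e3 : f (t + u) - f t - (p (t + u) - p t) = f (t + u) - p (t + u) - (f t - p t) := by
          abel
        rw [e3]
        calc u⁻¹ * ‖f (t + u) - p (t + u) - (f t - p t)‖ ≤
              u⁻¹ * (ε / σ * (Real.exp (-σ * t) - Real.exp (-σ * (t + u)))) := by gcongr
          _ = _ := by rw [mul_add, Real.exp_add]; ring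
      rw [integral_const_mul] at e2
      calc _ ≤ |c₀| * (ε / σ * Real.exp (-σ * t)) + (ε / σ * Real.exp (-σ * t)) * K0 := by
            refine (norm_add_le _ _).trans (add_le_add ?_ e2)
            rw [norm_smul, Real.norm_eq_abs]
            exact mul_le_mul_of_nonneg_left (hg0 t ht) (abs_nonneg _)
        _ = _ := by ring
    have hfin : ‖(∫ t in Ici 0, h t • (c₀ • f t + ∫ u in Ioi 0, u⁻¹ • (f (t + u) - f t) ∂ρ) ∂μ) -
        p 0‖ ≤ ε * ((|c₀| + K0) / σ) * E0 := by
      rw [← hpμ.2, ← integral_sub hDf hpμ.1, hE0, ← integral_const_mul]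
      refine norm_integral_le_of_norm_le (hEi.const_mul _) ?_
      exact (ae_restrict_iff' measurableSet_Ici).2 (Eventually.of_forall fun t ht => hDd t ht)
    have h00 := hg0 0 le_rfl
    rw [mul_zero, Real.exp_zero, mul_one] at h00
    have := norm_sub_le_norm_sub_add_norm_sub
      (∫ t in Ici 0, h t • (c₀ • f t + ∫ u in Ioi 0, u⁻¹ • (f (t + u) - f t) ∂ρ) ∂μ) (p 0) (f 0)
    rw [norm_sub_rev (p 0)] at this
    refine (this.trans (add_le_add hfin h00)).trans_eq ?_
    rw [hK]; ring
  have hlim : Tendsto (fun ε : ℝ => ε * K) (𝓝[>] 0) (𝓝 0) := by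
    have : Tendsto (fun ε : ℝ => ε * K) (𝓝 0) (𝓝 (0 * K)) := tendsto_id.mul_const K
    rw [zero_mul] at this
    exact this.mono_left nhdsWithin_le_nhds
  have := ge_of_tendsto hlim (eventually_mem_nhdsWithin.mono fun ε hε => main ε hε)
  exact sub_eq_zero.1 (norm_le_zero_iff.1 this)

lemma gen_deriv {X : Type*} [NormedAddCommGroup X] [NormedSpace ℂ X]
    (T : ℝ → X →L[ℂ] X)
    (hTadd : ∀ s t : ℝ, 0 ≤ s → 0 ≤ t → T (s + t) = (T s).comp (T t))
    (x y : X) (hxy : IsGen T x y) (v : ℝ) (hv : 0 ≤ v) :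
    HasDerivWithinAt (fun t => T t x) (T v y) (Ici v) v := by
  rw [← hasDerivWithinAt_Ioi_iff_Ici, hasDerivWithinAt_iff_tendsto_slope' self_notMem_Ioi]
  have h1 : Tendsto (fun t : ℝ => t - v) (𝓝[>] v) (𝓝[>] 0) := by
    refine tendsto_nhdsWithin_iff.2 ⟨?_, ?_⟩
    · have : Tendsto (fun t : ℝ => t - v) (𝓝 v) (𝓝 (v - v)) := tendsto_id.sub_const v
      rw [sub_self] at this
      exact this.mono_left nhdsWithin_le_nhds
    · filter_upwards [self_mem_nhdsWithin] with t ht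
      exact sub_pos.2 (show v < t from ht)
  have h2 := ((T v).continuous.tendsto y).comp (Tendsto.comp hxy h1)
  refine h2.congr' ?_
  filter_upwards [self_mem_nhdsWithin] with t ht
  have ht : v < t := ht
  have h3 : T t x = T v (T (t - v) x) := by
    have := hTadd v (t - v) hv (by linarith)
    rw [add_sub_cancel] at this
    rw [this]; rfl
  rw [slope_def_module, h3, ← map_sub]
  simp only [Function.comp]
  rw [← Complex.coe_smul, map_smul, Complex.coe_smul]

lemma gen_bound {X : Type*} [NormedAddCommGroup X] [NormedSpace ℂ X]
    (T : ℝ → X →L[ℂ] X)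
    (hT0 : T 0 = ContinuousLinearMap.id ℂ X)
    (hTadd : ∀ s t : ℝ, 0 ≤ s → 0 ≤ t → T (s + t) = (T s).comp (T t))
    (hTcont : ∀ x : X, ContinuousOn (fun t => T t x) (Ici (0 : ℝ)))
    (M : ℝ) (hM : ∀ t : ℝ, 0 ≤ t → ‖T t‖ ≤ M)
    (x y : X) (hxy : IsGen T x y) (u : ℝ) (hu : 0 ≤ u) :
    ‖T u x - x‖ ≤ M * ‖y‖ * u := by
  have := norm_image_sub_le_of_norm_deriv_right_le_segment (f := fun t => T t x)
    (f' := fun t => T t y) (C := M * ‖y‖) (a := 0) (b := u)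
    ((hTcont x).mono fun t ht => ht.1) (fun t ht => gen_deriv T hTadd x y hxy t ht.1)
    (fun t ht => (T t).le_of_opNorm_le (hM t ht.1) y) u ⟨hu, le_rfl⟩
  simpa [hT0] using this

/-- common bound for the regularized difference quotients -/
lemma reg_bound {X : Type*} [NormedAddCommGroup X] [NormedSpace ℂ X]
    (T : ℝ → X →L[ℂ] X)
    (hT0 : T 0 = ContinuousLinearMap.id ℂ X)
    (hTadd : ∀ s t : ℝ, 0 ≤ s → 0 ≤ t → T (s + t) = (T s).comp (T t))
    (hTcont : ∀ x : X, ContinuousOn (fun t => T t x) (Ici (0 : ℝ)))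
    (M : ℝ) (hM : ∀ t : ℝ, 0 ≤ t → ‖T t‖ ≤ M)
    (x y : X) (hxy : IsGen T x y) (s : ℝ) (hs : s ≤ 0) (hs1 : -1 ≤ s) (u : ℝ) (hu : 0 ≤ u) :
    ‖Real.exp (s * u) • T u x - x‖ ≤ (M * ‖x‖ + ‖x‖ + M * ‖y‖) ∧
    ‖Real.exp (s * u) • T u x - x‖ ≤ (M * ‖x‖ + ‖x‖ + M * ‖y‖) * u := by
  have hM0 : 0 ≤ M := (norm_nonneg _).trans (hM 0 le_rfl)
  have he1 : Real.exp (s * u) ≤ 1 := Real.exp_le_one_iff.2 (by nlinarith)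
  have he0 := Real.exp_pos (s * u)
  have hy : 0 ≤ M * ‖y‖ := by positivity
  have hx : 0 ≤ M * ‖x‖ := by positivity
  have hTu := (T u).le_of_opNorm_le (hM u hu) x
  constructor
  · refine (norm_sub_le _ _).trans ?_
    rw [norm_smul, Real.norm_of_nonneg he0.le]
    nlinarith [norm_nonneg (T u x)]
  · have e : Real.exp (s * u) • T u x - x =
        Real.exp (s * u) • (T u x - x) - (1 - Real.exp (s * u)) • x := by
      rw [smul_sub, sub_smul, one_smul]; abel
    rw [e]
    refine (norm_sub_le _ _).trans ?_
    rw [norm_smul, norm_smul, Real.norm_of_nonneg he0.le, Real.norm_of_nonneg (by linarith)]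
    have h1 := gen_bound T hT0 hTadd hTcont M hM x y hxy u hu
    have h2 := Real.add_one_le_exp (s * u)
    have h3 : Real.exp (s * u) * ‖T u x - x‖ ≤ M * ‖y‖ * u :=
      (mul_le_of_le_one_left (norm_nonneg _) he1).trans h1
    have h4 : (1 - Real.exp (s * u)) * ‖x‖ ≤ u * ‖x‖ := by
      gcongr; nlinarith
    have h5 : 0 ≤ M * ‖x‖ * u := by positivity
    nlinarith

lemma core_s {X : Type*} [NormedAddCommGroup X] [NormedSpace ℂ X] [CompleteSpace X]
    (T : ℝ → X →L[ℂ] X)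
    (hT0 : T 0 = ContinuousLinearMap.id ℂ X)
    (hTadd : ∀ s t : ℝ, 0 ≤ s → 0 ≤ t → T (s + t) = (T s).comp (T t))
    (hTcont : ∀ x : X, ContinuousOn (fun t => T t x) (Ici (0 : ℝ)))
    (M : ℝ) (hM : ∀ t : ℝ, 0 ≤ t → ‖T t‖ ≤ M)
    (ρ : Measure ℝ)
    (hρfin : ∀ r : ℝ, 0 < r → ρ (Ioc (0 : ℝ) r) < ⊤)
    (hρint : ∀ r : ℝ, 0 < r → IntegrableOn (fun u : ℝ => u⁻¹) (Ioi r) ρ)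
    (c₀ : ℝ) (μ : Measure ℝ) (h : ℝ → ℂ) (hnorm : ∀ t, ‖h t‖ = 1)
    (hlap : ∀ s : ℝ, s < 0 →
      IntegrableOn (fun t => Complex.exp ((s * t : ℝ) : ℂ) * h t) (Ici (0 : ℝ)) μ ∧
      ((c₀ + ∫ u in Ioi (0 : ℝ), (Real.exp (s * u) - 1) * u⁻¹ ∂ρ : ℝ) : ℂ) *
        (∫ t in Ici (0 : ℝ), Complex.exp ((s * t : ℝ) : ℂ) * h t ∂μ) = 1)
    (x y : X) (hxy : IsGen T x y) (s : ℝ) (hs : s < 0) (hs1 : -1 ≤ s)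
    (hint : ∀ z : X, IntegrableOn (fun t => h t • Real.exp (s * t) • T t z) (Ici 0) μ) :
    ∫ t in Ici 0, h t • Real.exp (s * t) •
      T t (c₀ • x + ∫ u in Ioi 0, u⁻¹ • (Real.exp (s * u) • T u x - x) ∂ρ) ∂μ = x := by
  have hRint : IntegrableOn (fun u => u⁻¹ • (Real.exp (s * u) • T u x - x)) (Ioi 0) ρ := by
    refine rhoInt ρ hρfin hρint (fun u => Real.exp (s * u) • T u x - x) ?_ _
      (fun u hu => (reg_bound T hT0 hTadd hTcont M hM x y hxy s hs.le hs1 u (le_of_lt hu)).1)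
      (fun u hu => (reg_bound T hT0 hTadd hTcont M hM x y hxy s hs.le hs1 u (le_of_lt hu)).2)
    have hc : ContinuousOn (fun t : ℝ => Real.exp (s * t)) (Ioi 0) := by fun_prop
    exact (hc.smul ((hTcont x).mono fun u (hu : 0 < u) => (hu.le : 0 ≤ u))).sub continuousOn_const
  set f : ℝ → X := fun t => Real.exp (s * t) • T t x with hfdef
  have hsh : ∀ t, 0 ≤ t → ∀ u, 0 < u → u⁻¹ • (f (t + u) - f t) =
      (((Real.exp (s * t) : ℝ) : ℂ) • T t) (u⁻¹ • (Real.exp (s * u) • T u x - x)) := by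
    intro t ht u hu
    simp only [hfdef]
    rw [hTadd t u ht hu.le, mul_add, Real.exp_add]
    rw [← Complex.coe_smul u⁻¹ (Real.exp (s * u) • T u x - x), map_smul, Complex.coe_smul]
    congr 1
    rw [smul_apply, Complex.coe_smul, map_sub,
      ← Complex.coe_smul (Real.exp (s * u)), map_smul, Complex.coe_smul, smul_sub, smul_smul]
    rfl
  have hfint : ∀ t, 0 ≤ t → IntegrableOn (fun u => u⁻¹ • (f (t + u) - f t)) (Ioi 0) ρ := by
    intro t ht
    refine IntegrableOn.congr_fun (ContinuousLinearMap.integrable_comp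
      (((Real.exp (s * t) : ℝ) : ℂ) • T t) hRint) (fun u hu => (hsh t ht u hu).symm)
      measurableSet_Ioi
  have hD : ∀ t, 0 ≤ t → c₀ • f t + ∫ u in Ioi 0, u⁻¹ • (f (t + u) - f t) ∂ρ =
      Real.exp (s * t) •
        T t (c₀ • x + ∫ u in Ioi 0, u⁻¹ • (Real.exp (s * u) • T u x - x) ∂ρ) := by
    intro t ht
    rw [setIntegral_congr_fun measurableSet_Ioi (hsh t ht),
      ContinuousLinearMap.integral_comp_comm _ hRint, map_add, ← Complex.coe_smul c₀ x, map_smul,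
      smul_add, smul_apply, Complex.coe_smul, Complex.coe_smul]
    congr 1
    exact smul_comm _ _ _
  have hdec : ∀ (r : ℝ) (z : X), r < 0 → Tendsto (fun t => Real.exp (r * t) • T t z) atTop (𝓝 0) := by
    intro r z hr
    have h1 : Tendsto (fun t : ℝ => Real.exp (r * t) * (M * ‖z‖)) atTop (𝓝 0) := by
      have := (Real.tendsto_exp_atBot.comp
        ((tendsto_id (α := ℝ)).const_mul_atTop_of_neg hr)).mul_const (M * ‖z‖)
      rwa [zero_mul] at this
    refine squeeze_zero_norm' ?_ h1
    filter_upwards [eventually_ge_atTop 0] with t ht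
    rw [norm_smul, Real.norm_of_nonneg (Real.exp_pos _).le]
    exact mul_le_mul_of_nonneg_left ((T t).le_of_opNorm_le (hM t ht) z) (Real.exp_pos _).le
  have hcon : ∀ (r : ℝ) (z : X), ContinuousOn (fun t => Real.exp (r * t) • T t z) (Ici 0) :=
    fun r z => by
      have hc : ContinuousOn (fun t : ℝ => Real.exp (r * t)) (Ici 0) := by fun_prop
      exact hc.smul (hTcont z)
  have key := core_abs ρ hρfin hρint c₀ μ h hnorm hlap (-s / 2) (by linarith) f
    (fun t => Real.exp (s / 2 * t) • T t (s • x + y)) (hcon _ _) ?_ (hcon _ _)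
    (hdec _ _ (by linarith)) (hdec _ _ hs) hfint ?_
  · rw [setIntegral_congr_fun measurableSet_Ici
      (g := fun t => h t • Real.exp (s * t) •
        T t (c₀ • x + ∫ u in Ioi 0, u⁻¹ • (Real.exp (s * u) • T u x - x) ∂ρ))
      (fun t ht => by simp only [hD t ht])] at key
    rw [key]
    simp [hfdef, hT0]
  · intro v hv
    have h1 : HasDerivAt (fun t => Real.exp (s * t)) (Real.exp (s * v) * (s * 1)) v :=
      ((hasDerivAt_id v).const_mul s).exp
    have h2 := h1.hasDerivWithinAt.smul (gen_deriv T hTadd x y hxy v hv)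
    refine h2.congr_deriv ?_
    rw [smul_smul, ← Real.exp_add, map_add, ← Complex.coe_smul s x, map_smul, Complex.coe_smul,
      smul_add, smul_smul, add_comm, mul_one]
    congr 3 <;> ring_nf
  · refine IntegrableOn.congr_fun (hint (c₀ • x +
      ∫ u in Ioi 0, u⁻¹ • (Real.exp (s * u) • T u x - x) ∂ρ)) (fun t ht => ?_) measurableSet_Ici
    simp only [hD t ht]

/-- Corollary 8 of the paper. `ψ(s) = c₀ + ∫_{(0,∞)}(e^{su}−1)u⁻¹dρ(u)`
is a nonpositive Bernstein function with Bochner–Phillips operator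
`ψ(A)y = c₀ y + ∫_{(0,∞)} u⁻¹ • (T(u)y − y) dρ(u)`. Suppose `1/ψ` is the Laplace transform
of a complex Borel measure `a` on `[0,∞)` (encoded as `da = h dμ`, `μ = |a|`, `‖h t‖ = 1`,
so `ψ(s)·∫₀^∞ e^{st} da(t) = 1` for `s < 0`), whose distribution function satisfies
`a({0}) = 0` and `a(t)‖T(t)x‖ → 0` for all `x`, and that
`(1/ψ)(A)x = ∫_{[0,∞)} h t • T t x ∂μ` is defined for all `x ∈ X` and bounded. Then for
every `x ∈ D(A)`: `ψ(A)((1/ψ)(A)x)` exists and `ψ(A)((1/ψ)(A)x) = x`, and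
`(1/ψ)(A)(ψ(A)x) = x`. -/
theorem stmt18 {X : Type*} [NormedAddCommGroup X] [NormedSpace ℂ X] [CompleteSpace X]
    (T : ℝ → X →L[ℂ] X)
    (hT0 : T 0 = ContinuousLinearMap.id ℂ X)
    (hTadd : ∀ s t : ℝ, 0 ≤ s → 0 ≤ t → T (s + t) = (T s).comp (T t))
    (hTcont : ∀ x : X, ContinuousOn (fun t => T t x) (Ici (0 : ℝ)))
    (hTbdd : ∃ M : ℝ, ∀ t : ℝ, 0 ≤ t → ‖T t‖ ≤ M)
    (ρ : Measure ℝ)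
    (hρfin : ∀ r : ℝ, 0 < r → ρ (Ioc (0 : ℝ) r) < ⊤)
    (hρint : ∀ r : ℝ, 0 < r → IntegrableOn (fun u : ℝ => u⁻¹) (Ioi r) ρ)
    (c₀ : ℝ) (hc₀ : c₀ ≤ 0)
    (μ : Measure ℝ) [SigmaFinite μ] [IsLocallyFiniteMeasure μ]
    (h : ℝ → ℂ) (hmeas : Measurable h) (hnorm : ∀ t, ‖h t‖ = 1)
    (hμ0 : μ ({0} : Set ℝ) = 0)
    (hlap : ∀ s : ℝ, s < 0 →
      IntegrableOn (fun t => Complex.exp ((s * t : ℝ) : ℂ) * h t) (Ici (0 : ℝ)) μ ∧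
      ((c₀ + ∫ u in Ioi (0 : ℝ), (Real.exp (s * u) - 1) * u⁻¹ ∂ρ : ℝ) : ℂ) *
        (∫ t in Ici (0 : ℝ), Complex.exp ((s * t : ℝ) : ℂ) * h t ∂μ) = 1)
    (hLMT : ∀ x : X, Tendsto (fun t => ‖distFun μ h t‖ * ‖T t x‖) atTop (𝓝 (0 : ℝ)))
    (hdef : ∀ x : X, IntegrableOn (fun t => h t • T t x) (Ici (0 : ℝ)) μ)
    (hbdd : ∃ C : ℝ, ∀ x : X, ‖∫ t in Ici (0 : ℝ), h t • T t x ∂μ‖ ≤ C * ‖x‖) :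
    ∀ x y : X, IsGen T x y →
      IntegrableOn
        (fun u => u⁻¹ • (T u (∫ t in Ici (0 : ℝ), h t • T t x ∂μ) -
          ∫ t in Ici (0 : ℝ), h t • T t x ∂μ)) (Ioi (0 : ℝ)) ρ ∧
      (c₀ • (∫ t in Ici (0 : ℝ), h t • T t x ∂μ) +
        ∫ u in Ioi (0 : ℝ),
          u⁻¹ • (T u (∫ t in Ici (0 : ℝ), h t • T t x ∂μ) -
            ∫ t in Ici (0 : ℝ), h t • T t x ∂μ) ∂ρ) = x ∧
      IntegrableOn (fun u => u⁻¹ • (T u x - x)) (Ioi (0 : ℝ)) ρ ∧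
      ∫ t in Ici (0 : ℝ),
        h t • T t (c₀ • x + ∫ u in Ioi (0 : ℝ), u⁻¹ • (T u x - x) ∂ρ) ∂μ = x := by
  intro x y hxy
  obtain ⟨M, hM⟩ := hTbdd
  obtain ⟨C, hC⟩ := hbdd
  have hTcomm : ∀ u t : ℝ, 0 ≤ u → 0 ≤ t → ∀ z, T u (T t z) = T t (T u z) := by
    intro u t hu ht z
    have h1 : T u (T t z) = T (u + t) z := by rw [hTadd u t hu ht]; rfl
    have h2 : T t (T u z) = T (t + u) z := by rw [hTadd t u ht hu]; rfl
    rw [h1, h2, add_comm]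
  -- the operator `(1/ψ)(A)` as a bounded operator
  let S : X →L[ℂ] X := LinearMap.mkContinuous
    { toFun := fun z => ∫ t in Ici (0 : ℝ), h t • T t z ∂μ
      map_add' := fun z w => by
        simp only [map_add, smul_add]
        exact integral_add (hdef z) (hdef w)
      map_smul' := fun c z => by
        simp only [map_smul, RingHom.id_apply]
        rw [← integral_smul]
        congr 1
        funext t
        exact smul_comm _ _ _ } C hC
  have hS : ∀ z, S z = ∫ t in Ici (0 : ℝ), h t • T t z ∂μ := fun z => rfl
  simp only [← hS]
  have hcomm : ∀ u, 0 ≤ u → ∀ z, T u (S z) = S (T u z) := by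
    intro u hu z
    rw [hS, hS, ← ContinuousLinearMap.integral_comp_comm _ (hdef z)]
    refine setIntegral_congr_fun measurableSet_Ici fun t ht => ?_
    simp only [map_smul]
    rw [hTcomm u t hu ht]
  -- integrability of the Bochner-Phillips integrand
  have hcT : ContinuousOn (fun u => T u x) (Ioi 0) :=
    (hTcont x).mono fun u (hu : 0 < u) => (hu.le : 0 ≤ u)
  have hRint : IntegrableOn (fun u => u⁻¹ • (T u x - x)) (Ioi 0) ρ := by
    have hb := fun u (hu : 0 < u) => reg_bound T hT0 hTadd hTcont M hM x y hxy 0 le_rfl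
      (by norm_num) u hu.le
    simp only [zero_mul, Real.exp_zero, one_smul] at hb
    exact rhoInt ρ hρfin hρint (fun u => T u x - x) (hcT.sub continuousOn_const) _
      (fun u hu => (hb u hu).1) (fun u hu => (hb u hu).2)
  have hsw : ∀ u ∈ Ioi (0 : ℝ), u⁻¹ • (T u (S x) - S x) = S (u⁻¹ • (T u x - x)) := by
    intro u hu
    rw [hcomm u (le_of_lt hu), ← map_sub, ← Complex.coe_smul, ← Complex.coe_smul, map_smul]
  set z : X := c₀ • x + ∫ u in Ioi (0 : ℝ), u⁻¹ • (T u x - x) ∂ρ with hz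
  have hfinal : S z = x := by
    have hexp : ∀ s : ℝ, s ≤ 0 → ∀ t ∈ Ici (0 : ℝ), Real.exp (s * t) ≤ 1 := fun s hs t ht =>
      Real.exp_le_one_iff.2 (mul_nonpos_of_nonpos_of_nonneg hs ht)
    have hbd : ∀ s : ℝ, s ≤ 0 → ∀ w, ∀ t ∈ Ici (0 : ℝ),
        ‖h t • Real.exp (s * t) • T t w‖ ≤ ‖h t • T t w‖ := by
      intro s hs w t ht
      rw [norm_smul, norm_smul, norm_smul, Real.norm_of_nonneg (Real.exp_pos _).le]
      exact mul_le_mul_of_nonneg_left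
        (mul_le_of_le_one_left (norm_nonneg _) (hexp s hs t ht)) (norm_nonneg _)
    have hme : ∀ s w, AEStronglyMeasurable (fun t => h t • Real.exp (s * t) • T t w)
        (μ.restrict (Ici 0)) := by
      intro s w
      have hc : Continuous fun t : ℝ => Real.exp (s * t) := by fun_prop
      refine (hc.aestronglyMeasurable.smul (hdef w).aestronglyMeasurable).congr
        (Eventually.of_forall fun t => ?_)
      exact smul_comm _ _ _
    have hint : ∀ s : ℝ, s ≤ 0 → ∀ w,
        IntegrableOn (fun t => h t • Real.exp (s * t) • T t w) (Ici 0) μ := by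
      intro s hs w
      refine Integrable.mono (hdef w) (hme s w) ?_
      exact (ae_restrict_iff' measurableSet_Ici).2 (Eventually.of_forall (hbd s hs w))
    let sn : ℕ → ℝ := fun n => -(1 / ((n : ℝ) + 1))
    have hsn : ∀ n, sn n < 0 := fun n => by
      simp only [sn]
      have : (0 : ℝ) < 1 / ((n : ℝ) + 1) := by positivity
      linarith
    have hsn1 : ∀ n, -1 ≤ sn n := fun n => by
      simp only [sn]
      have : 1 / ((n : ℝ) + 1) ≤ 1 := by
        rw [div_le_one (by positivity)]
        have : (0 : ℝ) ≤ n := Nat.cast_nonneg n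
        linarith
      linarith
    have hsn0 : Tendsto sn atTop (𝓝 0) := by
      have := (tendsto_one_div_add_atTop_nhds_zero_nat (𝕜 := ℝ)).neg
      rwa [neg_zero] at this
    have hexp0 : ∀ t : ℝ, Tendsto (fun n => Real.exp (sn n * t)) atTop (𝓝 1) := by
      intro t
      have := (Real.continuous_exp.tendsto _).comp (hsn0.mul_const t)
      rwa [zero_mul, Real.exp_zero] at this
    have hEi : ∀ n, IntegrableOn (fun t => Real.exp (sn n * t)) (Ici 0) μ := by
      intro n
      refine (hlap (sn n) (hsn n)).1.norm.congr (Eventually.of_forall fun t => ?_)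
      simp only [norm_mul, hnorm, mul_one, Complex.norm_exp, Complex.ofReal_re]
    let Sn : ℕ → X →L[ℂ] X := fun n => LinearMap.mkContinuous
      { toFun := fun w => ∫ t in Ici (0 : ℝ), h t • Real.exp (sn n * t) • T t w ∂μ
        map_add' := fun w w' => by
          simp only [map_add, smul_add]
          exact integral_add (hint _ (hsn n).le w) (hint _ (hsn n).le w')
        map_smul' := fun c w => by
          simp only [map_smul, RingHom.id_apply]
          rw [← integral_smul]
          congr 1
          funext t
          rw [smul_comm (Real.exp (sn n * t)) c, smul_comm (h t) c] }
      ((∫ t in Ici (0 : ℝ), Real.exp (sn n * t) ∂μ) * M) (fun w => by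
        simp only [LinearMap.coe_mk, AddHom.coe_mk]
        rw [mul_assoc, ← integral_mul_const]
        refine norm_integral_le_of_norm_le ((hEi n).mul_const _) ?_
        refine (ae_restrict_iff' measurableSet_Ici).2 (Eventually.of_forall fun t ht => ?_)
        rw [norm_smul, hnorm, one_mul, norm_smul, Real.norm_of_nonneg (Real.exp_pos _).le]
        exact mul_le_mul_of_nonneg_left ((T t).le_of_opNorm_le (hM t ht) w) (Real.exp_pos _).le)
    have hSn : ∀ n w, Sn n w = ∫ t in Ici (0 : ℝ), h t • Real.exp (sn n * t) • T t w ∂μ :=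
      fun n w => rfl
    obtain ⟨C', hC'⟩ := banach_steinhaus (g := Sn) (fun w =>
      ⟨∫ t in Ici (0 : ℝ), ‖h t • T t w‖ ∂μ, fun n => by
        rw [hSn]
        refine norm_integral_le_of_norm_le (hdef w).norm ?_
        exact (ae_restrict_iff' measurableSet_Ici).2
          (Eventually.of_forall (hbd _ (hsn n).le w))⟩)
    have hlim1 : ∀ w, Tendsto (fun n => Sn n w) atTop (𝓝 (S w)) := by
      intro w
      simp only [hSn, hS]
      refine tendsto_integral_of_dominated_convergence (fun t => ‖h t • T t w‖)
        (fun n => hme _ w) (hdef w).norm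
        (fun n => (ae_restrict_iff' measurableSet_Ici).2
          (Eventually.of_forall (hbd _ (hsn n).le w))) (Eventually.of_forall fun t => ?_)
      have := ((hexp0 t).smul_const (T t w)).const_smul (h t)
      rwa [one_smul] at this
    let zn : ℕ → X := fun n =>
      c₀ • x + ∫ u in Ioi 0, u⁻¹ • (Real.exp (sn n * u) • T u x - x) ∂ρ
    have hzn : ∀ n, Sn n (zn n) = x := fun n =>
      core_s T hT0 hTadd hTcont M hM ρ hρfin hρint c₀ μ h hnorm hlap x y hxy (sn n) (hsn n)
        (hsn1 n) (hint _ (hsn n).le)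
    have hM0 : 0 ≤ M := (norm_nonneg _).trans (hM 0 le_rfl)
    set B := M * ‖x‖ + ‖x‖ + M * ‖y‖ with hB
    have hB0 : 0 ≤ B := by positivity
    have hlim2 : Tendsto zn atTop (𝓝 z) := by
      refine Tendsto.const_add _ ?_
      refine tendsto_integral_of_dominated_convergence (fun u => u⁻¹ • (B * min 1 u)) ?_ ?_ ?_ ?_
      · intro n
        refine ContinuousOn.aestronglyMeasurable ?_ measurableSet_Ioi
        have hc : ContinuousOn (fun t : ℝ => Real.exp (sn n * t)) (Ioi 0) := by fun_prop
        have hi : ContinuousOn (fun t : ℝ => t⁻¹) (Ioi 0) :=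
          continuousOn_inv₀.mono fun u hu => ne_of_gt hu
        exact hi.smul ((hc.smul hcT).sub continuousOn_const)
      · refine rhoInt ρ hρfin hρint (fun u => B * min 1 u) (by fun_prop) B ?_ ?_
        · intro u hu
          rw [Real.norm_of_nonneg (by positivity)]
          exact mul_le_of_le_one_right hB0 (min_le_left _ _)
        · intro u hu
          rw [Real.norm_of_nonneg (by positivity)]
          exact mul_le_mul_of_nonneg_left (min_le_right _ _) hB0
      · intro n
        refine (ae_restrict_iff' measurableSet_Ioi).2 (Eventually.of_forall fun u hu => ?_)
        have hu : 0 < u := hu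
        have hb := reg_bound T hT0 hTadd hTcont M hM x y hxy (sn n) (hsn n).le (hsn1 n) u hu.le
        rw [norm_smul, norm_inv, Real.norm_of_nonneg hu.le, smul_eq_mul]
        refine mul_le_mul_of_nonneg_left ?_ (inv_nonneg.2 hu.le)
        rcases min_choice 1 u with h1 | h1
        · rw [h1, mul_one]; exact hb.1
        · rw [h1]; exact hb.2
      · refine Eventually.of_forall fun u => ?_
        have := (((hexp0 u).smul_const (T u x)).sub_const x).const_smul u⁻¹
        rwa [one_smul] at this
    have hlim3 : Tendsto (fun n => Sn n (zn n - z)) atTop (𝓝 0) := by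
      have h1 : Tendsto (fun n => C' * ‖zn n - z‖) atTop (𝓝 0) := by
        have := ((hlim2.sub_const z).norm).const_mul C'
        rwa [sub_self, norm_zero, mul_zero] at this
      exact squeeze_zero_norm (fun n => (Sn n).le_of_opNorm_le (hC' n) _) h1
    have hlim4 := hlim3.add (hlim1 z)
    simp only [← map_add, sub_add_cancel, hzn, zero_add] at hlim4
    exact tendsto_nhds_unique hlim4 tendsto_const_nhds
  refine ⟨?_, ?_, hRint, hfinal⟩
  · exact IntegrableOn.congr_fun (S.integrable_comp hRint) (fun u hu => (hsw u hu).symm)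
      measurableSet_Ioi
  · rw [setIntegral_congr_fun measurableSet_Ioi hsw, S.integral_comp_comm hRint,
      ← Complex.coe_smul, ← map_smul, ← map_add, Complex.coe_smul]
    exact hfinal
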